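/- Let α, c₃, c₄, c₅ be real constants and let v : ℝ × ℝ → ℝ be a smooth function of (x,t) with v_x(x,t) > 0 and v_xx(x,t) ≠ 0 for all (x,t), satisfying the evolution equation v_t = −v_x²/v_xx + c₃·v + c₄·v_x·ln(v_x) + c₄ + c₅·v_x. Define η : ℝ × ℝ → ℝ by η = (27/4)·v_x³ v_xxx / v_xx³ − (27/4)·v_x²/v_xx + α(c₃−1)·x·v_x + c₃·((27 c₃)/4 − 27/4 − α)·v + (27/4)(c₄ + c₃ c₅)·v_x + ((27 c₃ c₄)/4 + α c₅)·v_x·ln(v_x) + (α c₄/2)·v_x·(ln v_x)² + c₄·((27/4)(c₃ − 1) − α). Then η satisfies the linearized equation ∂η/∂t = c₃·η + ( −2 v_x/v_xx + c₄·ln(v_x) + c₄ + c₅ )·∂η/∂x + ( v_x²/v_xx² )·∂²η/∂x² at every point (x,t). -/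

import Mathlib

/-- Partial derivative with respect to the first (space) variable. -/
noncomputable def pdx (f : ℝ × ℝ → ℝ) : ℝ × ℝ → ℝ :=
  fun p => deriv (fun x => f (x, p.2)) p.1

/-- Partial derivative with respect to the second (time) variable. -/
noncomputable def pdt (f : ℝ × ℝ → ℝ) : ℝ × ℝ → ℝ :=
  fun p => deriv (fun t => f (p.1, t)) p.2

theorem pdx_eq_fderiv {f : ℝ × ℝ → ℝ} (hf : Differentiable ℝ f) :
    pdx f = fun p => fderiv ℝ f p (1, 0) := by
  funext p
  have h : HasDerivAt (fun x : ℝ => (x, p.2)) ((1 : ℝ), (0 : ℝ)) p.1 :=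
    (hasDerivAt_id p.1).prodMk (hasDerivAt_const p.1 p.2)
  exact ((hf p).hasFDerivAt.comp_hasDerivAt p.1 h).deriv

theorem pdt_eq_fderiv {f : ℝ × ℝ → ℝ} (hf : Differentiable ℝ f) :
    pdt f = fun p => fderiv ℝ f p (0, 1) := by
  funext p
  have h : HasDerivAt (fun t : ℝ => (p.1, t)) ((0 : ℝ), (1 : ℝ)) p.2 :=
    (hasDerivAt_const p.2 p.1).prodMk (hasDerivAt_id p.2)
  exact ((hf p).hasFDerivAt.comp_hasDerivAt p.2 h).deriv

theorem ContDiff.pdx {f : ℝ × ℝ → ℝ} (hf : ContDiff ℝ (⊤ : ℕ∞) f) :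
    ContDiff ℝ (⊤ : ℕ∞) (pdx f) := by
  rw [pdx_eq_fderiv (hf.differentiable (by simp))]
  exact (hf.fderiv_right (by simp)).clm_apply contDiff_const

theorem ContDiff.hasDerivAt_pdx {f : ℝ × ℝ → ℝ} (hf : ContDiff ℝ (⊤ : ℕ∞) f) (p : ℝ × ℝ) :
    HasDerivAt (fun x => f (x, p.2)) (_root_.pdx f p) p.1 := by
  have hd : Differentiable ℝ f := hf.differentiable (by simp)
  have : Differentiable ℝ (fun x : ℝ => f (x, p.2)) := by fun_prop
  exact (this p.1).hasDerivAt

theorem ContDiff.hasDerivAt_pdt {f : ℝ × ℝ → ℝ} (hf : ContDiff ℝ (⊤ : ℕ∞) f) (p : ℝ × ℝ) :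
    HasDerivAt (fun t => f (p.1, t)) (pdt f p) p.2 := by
  have hd : Differentiable ℝ f := hf.differentiable (by simp)
  have : Differentiable ℝ (fun t : ℝ => f (p.1, t)) := by fun_prop
  exact (this p.2).hasDerivAt

theorem ContDiff.pdt_pdx_comm {f : ℝ × ℝ → ℝ} (hf : ContDiff ℝ (⊤ : ℕ∞) f) :
    pdt (_root_.pdx f) = _root_.pdx (pdt f) := by
  have hd : Differentiable ℝ f := hf.differentiable (by simp)
  have hf' : ContDiff ℝ (⊤ : ℕ∞) (fderiv ℝ f) := hf.fderiv_right (by simp)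
  have hd' : Differentiable ℝ (fderiv ℝ f) := hf'.differentiable (by simp)
  have happly (w : ℝ × ℝ) : Differentiable ℝ (fun p => fderiv ℝ f p w) := by fun_prop
  rw [pdx_eq_fderiv hd, pdt_eq_fderiv hd, pdt_eq_fderiv (happly _), pdx_eq_fderiv (happly _)]
  funext p
  have hsymm : IsSymmSndFDerivAt ℝ f p :=
    hf.contDiffAt.isSymmSndFDerivAt (by
      rw [minSmoothness_of_isRCLikeNormedField]
      exact WithTop.coe_le_coe.2 le_top)
  have hsnd (w : ℝ × ℝ) : fderiv ℝ (fun q => fderiv ℝ f q w) p =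
      (fderiv ℝ (fderiv ℝ f) p).flip w := by
    ext <;> simp [fderiv_clm_apply (hd' p) (differentiableAt_const w)]
  rw [hsnd, hsnd]
  exact hsymm (0, 1) (1, 0)

/-- Concluding-remarks example (equations (L-Ex) and (vt-27-g)): for a solution of
`v_t = −v_x²/v_xx + c₃ v + c₄ v_x ln(v_x) + c₄ + c₅ v_x`, the indicated third-order
expression `η` satisfies the linearized (Lie–Bäcklund symmetry) equation. -/
theorem concluding_example_third_order_symmetry
    (α c3 c4 c5 : ℝ) (v : ℝ × ℝ → ℝ) (hv : ContDiff ℝ (⊤ : ℕ∞) v)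
    (hvx : ∀ p : ℝ × ℝ, 0 < pdx v p)
    (hvxx : ∀ p : ℝ × ℝ, pdx (pdx v) p ≠ 0)
    (heq : ∀ p : ℝ × ℝ, pdt v p =
      -(pdx v p) ^ 2 / pdx (pdx v) p + c3 * v p
        + c4 * pdx v p * Real.log (pdx v p) + c4 + c5 * pdx v p)
    (η : ℝ × ℝ → ℝ)
    (hη : η = fun p =>
      (27 / 4) * (pdx v p) ^ 3 * pdx (pdx (pdx v)) p / (pdx (pdx v) p) ^ 3
        - (27 / 4) * (pdx v p) ^ 2 / pdx (pdx v) p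
        + α * (c3 - 1) * p.1 * pdx v p
        + c3 * (27 * c3 / 4 - 27 / 4 - α) * v p
        + (27 / 4) * (c4 + c3 * c5) * pdx v p
        + (27 * c3 * c4 / 4 + α * c5) * pdx v p * Real.log (pdx v p)
        + (α * c4 / 2) * pdx v p * (Real.log (pdx v p)) ^ 2
        + c4 * ((27 / 4) * (c3 - 1) - α)) :
    ∀ p : ℝ × ℝ, pdt η p =
      c3 * η p
      + (-2 * pdx v p / pdx (pdx v) p + c4 * Real.log (pdx v p) + c4 + c5) * pdx η p
      + ((pdx v p) ^ 2 / (pdx (pdx v) p) ^ 2) * pdx (pdx η) p := by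
  have h0 := hv
  have h1 := h0.pdx
  have h2 := h1.pdx
  have h3 := h2.pdx
  have h4 := h3.pdx
  have ht1 : pdt (pdx v) = pdx (pdt v) := h0.pdt_pdx_comm
  have ht2 : pdt (pdx (pdx v)) = pdx (pdx (pdt v)) := by rw [h1.pdt_pdx_comm, ht1]
  have ht3 : pdt (pdx (pdx (pdx v))) = pdx (pdx (pdx (pdt v))) := by
    rw [h2.pdt_pdx_comm, ht2]
  have d0 := h0.hasDerivAt_pdx
  have d1 := h1.hasDerivAt_pdx
  have d2 := h2.hasDerivAt_pdx
  have d3 := h3.hasDerivAt_pdx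
  have d4 := h4.hasDerivAt_pdx
  have s0 := h0.hasDerivAt_pdt
  have s1 := h1.hasDerivAt_pdt
  have s2 := h2.hasDerivAt_pdt
  have s3 := h3.hasDerivAt_pdt
  rw [ht1] at s1
  rw [ht2] at s2
  rw [ht3] at s3
  clear ht1 ht2 ht3 h0 h1 h2 h3 h4
  have eq0 : pdt v = _ := funext heq
  rw [eq0] at s0 s1 s2 s3
  clear eq0 heq hv
  generalize pdx (pdx (pdx (pdx (pdx v)))) = e at *
  generalize pdx (pdx (pdx (pdx v))) = d at *
  generalize pdx (pdx (pdx v)) = w at *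
  generalize pdx (pdx v) = b at *
  generalize pdx v = a at *
  have ha (p : ℝ × ℝ) : a p ≠ 0 := (hvx p).ne'
  have l1 (p : ℝ × ℝ) : HasDerivAt (fun x => Real.log (a (x, p.2))) (b p / a p) p.1 :=
    (d1 p).log (ha p)
  have lt (p : ℝ × ℝ) {a' : ℝ} (h : HasDerivAt (fun t => a (p.1, t)) a' p.2) :
      HasDerivAt (fun t => Real.log (a (p.1, t))) (a' / a p) p.2 := h.log (ha p)
  have e1 : pdx (fun p => -(a p) ^ 2 / b p + c3 * v p + c4 * a p * Real.log (a p) + c4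
      + c5 * a p) = fun p => -2 * a p + a p ^ 2 * w p / b p ^ 2 + c3 * a p
        + c4 * b p * (Real.log (a p) + 1) + c5 * b p := by
    funext p
    have hd := ((((((d1 p).pow 2).neg.div (d2 p) (hvxx p)).add ((d0 p).const_mul c3)).add
      (((d1 p).const_mul c4).mul (l1 p))).add_const c4).add ((d1 p).const_mul c5)
    refine HasDerivAt.deriv (hd.congr_deriv ?_)
    clear hd
    have := ha p
    have := hvxx p
    simp
    field_simp
  have e2 : pdx (fun p => -2 * a p + a p ^ 2 * w p / b p ^ 2 + c3 * a p
        + c4 * b p * (Real.log (a p) + 1) + c5 * b p) = fun p =>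
      -2 * b p + 2 * a p * w p / b p + a p ^ 2 * d p / b p ^ 2 - 2 * a p ^ 2 * w p ^ 2 / b p ^ 3
        + c3 * b p + c4 * w p * (Real.log (a p) + 1) + c4 * b p ^ 2 / a p + c5 * w p := by
    funext p
    have hd := (((((d1 p).const_mul (-2)).add
      ((((d1 p).pow 2).mul (d3 p)).div ((d2 p).pow 2) (pow_ne_zero 2 (hvxx p)))).add
      ((d1 p).const_mul c3)).add (((d2 p).const_mul c4).mul ((l1 p).add_const 1))).add
      ((d2 p).const_mul c5)
    refine HasDerivAt.deriv (hd.congr_deriv ?_)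
    clear hd
    have := ha p
    have := hvxx p
    simp
    field_simp
    ring
  have e3 : pdx (fun p =>
      -2 * b p + 2 * a p * w p / b p + a p ^ 2 * d p / b p ^ 2 - 2 * a p ^ 2 * w p ^ 2 / b p ^ 3
        + c3 * b p + c4 * w p * (Real.log (a p) + 1) + c4 * b p ^ 2 / a p + c5 * w p) =
      fun p => 4 * a p * d p / b p - 6 * a p * w p ^ 2 / b p ^ 2 + a p ^ 2 * e p / b p ^ 2
        - 6 * a p ^ 2 * w p * d p / b p ^ 3 + 6 * a p ^ 2 * w p ^ 3 / b p ^ 4 + c3 * w p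
        + c4 * d p * (Real.log (a p) + 1) + 3 * c4 * b p * w p / a p - c4 * b p ^ 3 / a p ^ 2
        + c5 * d p := by
    funext p
    have hd := ((((((((d2 p).const_mul (-2)).add
      ((((d1 p).const_mul 2).mul (d3 p)).div (d2 p) (hvxx p))).add
      ((((d1 p).pow 2).mul (d4 p)).div ((d2 p).pow 2) (pow_ne_zero 2 (hvxx p)))).sub
      (((((d1 p).pow 2).const_mul 2).mul ((d3 p).pow 2)).div ((d2 p).pow 3)
        (pow_ne_zero 3 (hvxx p)))).add
      ((d2 p).const_mul c3)).add (((d3 p).const_mul c4).mul ((l1 p).add_const 1))).add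
      ((((d2 p).pow 2).const_mul c4).div (d1 p) (ha p))).add
      ((d3 p).const_mul c5)
    refine HasDerivAt.deriv (hd.congr_deriv ?_)
    clear hd
    have := ha p
    have := hvxx p
    simp
    field_simp
    ring
  rw [e1] at s1
  rw [e1, e2] at s2
  rw [e1, e2, e3] at s3
  clear e1 e2 e3
  have n1 : pdx η = fun p => 27 / 4 * (3 * a p ^ 2 * w p / b p ^ 2 + a p ^ 3 * d p / b p ^ 3
        - 3 * a p ^ 3 * w p ^ 2 / b p ^ 4) - 27 / 4 * (2 * a p - a p ^ 2 * w p / b p ^ 2)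
        + α * (c3 - 1) * (a p + p.1 * b p) + c3 * (27 * c3 / 4 - 27 / 4 - α) * a p
        + (27 / 4) * (c4 + c3 * c5) * b p
        + (27 * c3 * c4 / 4 + α * c5) * (b p * (Real.log (a p) + 1))
        + (α * c4 / 2) * (b p * (Real.log (a p) ^ 2 + 2 * Real.log (a p))) := by
    rw [hη]
    funext p
    have hd := (((((((((((d1 p).pow 3).const_mul (27 / 4)).mul (d3 p)).div ((d2 p).pow 3)
      (pow_ne_zero 3 (hvxx p))).sub
      ((((d1 p).pow 2).const_mul (27 / 4)).div (d2 p) (hvxx p))).add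
      (((hasDerivAt_id p.1).const_mul (α * (c3 - 1))).mul (d1 p))).add
      ((d0 p).const_mul (c3 * (27 * c3 / 4 - 27 / 4 - α)))).add
      ((d1 p).const_mul ((27 / 4) * (c4 + c3 * c5)))).add
      (((d1 p).const_mul (27 * c3 * c4 / 4 + α * c5)).mul (l1 p))).add
      (((d1 p).const_mul (α * c4 / 2)).mul ((l1 p).pow 2))).add_const
      (c4 * ((27 / 4) * (c3 - 1) - α))
    refine HasDerivAt.deriv (hd.congr_deriv ?_)
    clear hd
    have := ha p
    have := hvxx p
    simp
    field_simp
  have n2 : pdx (pdx η) = fun p => 27 / 4 * (6 * a p * w p / b p + 6 * a p ^ 2 * d p / b p ^ 2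
        - 15 * a p ^ 2 * w p ^ 2 / b p ^ 3 + a p ^ 3 * e p / b p ^ 3
        - 9 * a p ^ 3 * w p * d p / b p ^ 4 + 12 * a p ^ 3 * w p ^ 3 / b p ^ 5)
        - 27 / 4 * (2 * b p - 2 * a p * w p / b p - a p ^ 2 * d p / b p ^ 2
          + 2 * a p ^ 2 * w p ^ 2 / b p ^ 3)
        + α * (c3 - 1) * (2 * b p + p.1 * w p) + c3 * (27 * c3 / 4 - 27 / 4 - α) * b p
        + (27 / 4) * (c4 + c3 * c5) * w p
        + (27 * c3 * c4 / 4 + α * c5) * (w p * (Real.log (a p) + 1) + b p ^ 2 / a p)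
        + (α * c4 / 2) * (w p * (Real.log (a p) ^ 2 + 2 * Real.log (a p))
          + b p ^ 2 / a p * (2 * Real.log (a p) + 2)) := by
    rw [n1]
    funext p
    have hd := (((((((((((((d1 p).pow 2).const_mul 3).mul (d3 p)).div ((d2 p).pow 2)
        (pow_ne_zero 2 (hvxx p))).add
        ((((d1 p).pow 3).mul (d4 p)).div ((d2 p).pow 3) (pow_ne_zero 3 (hvxx p)))).sub
        (((((d1 p).pow 3).const_mul 3).mul ((d3 p).pow 2)).div ((d2 p).pow 4)
          (pow_ne_zero 4 (hvxx p)))).const_mul (27 / 4)).sub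
      ((((d1 p).const_mul 2).sub ((((d1 p).pow 2).mul (d3 p)).div ((d2 p).pow 2)
        (pow_ne_zero 2 (hvxx p)))).const_mul (27 / 4))).add
      (((d1 p).add ((hasDerivAt_id p.1).mul (d2 p))).const_mul (α * (c3 - 1)))).add
      ((d1 p).const_mul (c3 * (27 * c3 / 4 - 27 / 4 - α)))).add
      ((d2 p).const_mul ((27 / 4) * (c4 + c3 * c5)))).add
      (((d2 p).mul ((l1 p).add_const 1)).const_mul (27 * c3 * c4 / 4 + α * c5))).add
      (((d2 p).mul (((l1 p).pow 2).add ((l1 p).const_mul 2))).const_mul (α * c4 / 2))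
    refine HasDerivAt.deriv (hd.congr_deriv ?_)
    clear hd
    have := ha p
    have := hvxx p
    simp
    field_simp
    ring
  intro p
  rw [n2, n1, hη]
  have hd := (((((((((((s1 p).pow 3).const_mul (27 / 4)).mul (s3 p)).div ((s2 p).pow 3)
    (pow_ne_zero 3 (hvxx p))).sub
    ((((s1 p).pow 2).const_mul (27 / 4)).div (s2 p) (hvxx p))).add
    ((s1 p).const_mul (α * (c3 - 1) * p.1))).add
    ((s0 p).const_mul (c3 * (27 * c3 / 4 - 27 / 4 - α)))).add
    ((s1 p).const_mul ((27 / 4) * (c4 + c3 * c5)))).add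
    (((s1 p).const_mul (27 * c3 * c4 / 4 + α * c5)).mul (lt p (s1 p)))).add
    (((s1 p).const_mul (α * c4 / 2)).mul ((lt p (s1 p)).pow 2))).add_const
    (c4 * ((27 / 4) * (c3 - 1) - α))
  refine HasDerivAt.deriv (hd.congr_deriv ?_)
  clear hd
  have := ha p
  have := hvxx p
  simp
  field_simp
  ring
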